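/- arXiv:2306.15439 — 3 statements merged into one kernel-verified Lean document; each statement's English description precedes it below -/
import Mathlib

section
/- Let D be an integral domain and let R be a retract D-algebra with R ≠ D (the structure map D → R is not surjective). Then the Krull dimension of R is at least the Krull dimension of D plus one. -/
/-- Let `D` be an integral domain and `R` a retract `D`-algebra with
`R ≠ D` (the structure map `D → R` is not surjective).  Then
`dim R ≥ dim D + 1` (Krull dimensions). -/
theorem retract_krullDim_ge (D R : Type*) [CommRing D] [IsDomain D]
    [CommRing R] [IsDomain R] [Algebra D R] (h : Nonempty (R →ₐ[D] D))
    (hne : ¬ Function.Surjective (algebraMap D R)) :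
    ringKrullDim D + 1 ≤ ringKrullDim R := by
  obtain ⟨ε⟩ := h
  obtain ⟨x, hx⟩ := not_forall.mp hne
  have hr : x - algebraMap D R (ε x) ∈ nonZeroDivisors R :=
    mem_nonZeroDivisors_of_ne_zero fun h0 => hx ⟨ε x, (sub_eq_zero.mp h0).symm⟩
  refine ringKrullDim_succ_le_of_surjective (ε : R →+* D)
    (fun d => ⟨algebraMap D R d, ε.commutes d⟩) hr ?_
  simp
end

section
/- Let D ⊊ R be a proper integral extension of integral domains. Then R is not a retract D-algebra, i.e., there exists no D-algebra homomorphism R → D. -/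
/-- Let `D ⊊ R` be a proper integral extension of integral domains.
Then `R` is not a retract `D`-algebra: there is no `D`-algebra homomorphism `R → D`. -/
theorem no_retract_of_proper_integral_extension (D R : Type*) [CommRing D] [IsDomain D]
    [CommRing R] [IsDomain R] [Algebra D R]
    (hinj : Function.Injective (algebraMap D R)) [Algebra.IsIntegral D R]
    (hne : ¬ Function.Surjective (algebraMap D R)) :
    IsEmpty (R →ₐ[D] D) := by
  refine ⟨fun f => hne fun x => ⟨f x, ?_⟩⟩
  have hker : RingHom.ker f = ⊥ := by
    refine Ideal.eq_bot_of_comap_eq_bot (R := D) ((Submodule.eq_bot_iff _).2 fun d hd => ?_)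
    simpa [RingHom.mem_ker] using hd
  exact (RingHom.injective_iff_ker_eq_bot f).2 hker (by simp)
end

section
/- Let D be an integral domain with quotient field K, let T be an overring of D (a ring with D ⊆ T ⊆ K), and let R be a retract D-algebra. Then RT, the subring of the quotient field of R consisting of all finite sums Σ rᵢtᵢ with rᵢ ∈ R and tᵢ ∈ T, is a retract T-algebra. -/
/-- `y` is the value at `x` of the extension of `ε : R →+* D` to fractions with nonzero
denominator in `D`. -/
def RetractValue {F : Type*} [Field F] {D R : Subring F} (ε : R →+* D) (x y : F) : Prop :=
  ∃ d : D, d ≠ 0 ∧ ∃ r : R, (d : F) * x = r ∧ (d : F) * y = ε r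

namespace RetractValue

variable {F : Type*} [Field F] {D R : Subring F} {ε : R →+* D} {x y x' y' : F}

theorem of_mem (r : R) : RetractValue ε (r : F) (ε r : F) :=
  ⟨1, one_ne_zero, r, by simp, by simp⟩

theorem neg (h : RetractValue ε x y) : RetractValue ε (-x) (-y) := by
  obtain ⟨d, hd, r, hx, hy⟩ := h
  exact ⟨d, hd, -r, by simp [hx], by simp [hy]⟩

theorem mul (h : RetractValue ε x y) (h' : RetractValue ε x' y') :
    RetractValue ε (x * x') (y * y') := by
  obtain ⟨d, hd, r, hx, hy⟩ := h
  obtain ⟨d', hd', r', hx', hy'⟩ := h'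
  refine ⟨d * d', mul_ne_zero hd hd', r * r', ?_, ?_⟩
  · push_cast
    rw [← hx, ← hx']
    ring
  · rw [map_mul]
    push_cast
    rw [← hy, ← hy']
    ring

theorem add (hDR : D ≤ R) (hε : ∀ d : D, ε (Subring.inclusion hDR d) = d)
    (h : RetractValue ε x y) (h' : RetractValue ε x' y') :
    RetractValue ε (x + x') (y + y') := by
  obtain ⟨d, hd, r, hx, hy⟩ := h
  obtain ⟨d', hd', r', hx', hy'⟩ := h'
  refine ⟨d * d', mul_ne_zero hd hd',
    Subring.inclusion hDR d' * r + Subring.inclusion hDR d * r', ?_, ?_⟩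
  · push_cast
    rw [← hx, ← hx', Subring.coe_inclusion, Subring.coe_inclusion]
    ring
  · rw [map_add, map_mul, map_mul, hε, hε]
    push_cast
    rw [← hy, ← hy']
    ring

theorem unique (hDR : D ≤ R) (hε : ∀ d : D, ε (Subring.inclusion hDR d) = d)
    (h : RetractValue ε x y) (h' : RetractValue ε x y') : y = y' := by
  obtain ⟨d, hd, r, hx, hy⟩ := h
  obtain ⟨d', hd', r', hx', hy'⟩ := h'
  have hr : Subring.inclusion hDR d' * r = Subring.inclusion hDR d * r' := by
    apply Subtype.ext
    push_cast
    rw [← hx, ← hx', Subring.coe_inclusion, Subring.coe_inclusion]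
    ring
  have hεr := congrArg (fun z => (ε z : F)) hr
  simp only [map_mul, hε, Subring.coe_mul, ← hy, ← hy'] at hεr
  have hdd : (d : F) * d' ≠ 0 := mul_ne_zero (by simpa using hd) (by simpa using hd')
  exact mul_left_cancel₀ hdd (by linear_combination hεr)

theorem self_of_mem_closure (hDR : D ≤ R) (hε : ∀ d : D, ε (Subring.inclusion hDR d) = d)
    (hx : x ∈ Subfield.closure (D : Set F)) : RetractValue ε x x := by
  obtain ⟨a, ha, b, hb, rfl⟩ := Subfield.mem_closure_iff.mp hx
  rw [Subring.closure_eq] at ha hb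
  by_cases hb0 : b = 0
  · exact ⟨1, one_ne_zero, 0, by simp [hb0], by simp [hb0]⟩
  · have hba : b * (a / b) = a := by field_simp
    exact ⟨⟨b, hb⟩, by simpa [Subtype.ext_iff] using hb0, Subring.inclusion hDR ⟨a, ha⟩,
      hba, by rw [hε]; exact hba⟩

theorem exists_of_mem_closure {T : Subring F} (hDR : D ≤ R) (hDT : D ≤ T)
    (hTK : (T : Set F) ⊆ (Subfield.closure (D : Set F) : Set F))
    (hε : ∀ d : D, ε (Subring.inclusion hDR d) = d)
    (hx : x ∈ Subring.closure ((R : Set F) ∪ (T : Set F))) :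
    ∃ y : T, RetractValue ε x y := by
  induction hx using Subring.closure_induction with
  | mem x hx =>
    rcases hx with hx | hx
    · exact ⟨⟨ε ⟨x, hx⟩, hDT (ε ⟨x, hx⟩).2⟩, of_mem ⟨x, hx⟩⟩
    · exact ⟨⟨x, hx⟩, self_of_mem_closure hDR hε (hTK hx)⟩
  | zero => exact ⟨0, by simpa using of_mem (ε := ε) 0⟩
  | one => exact ⟨1, by simpa using of_mem (ε := ε) 1⟩
  | add x x' _ _ h h' =>
    obtain ⟨y, hy⟩ := h
    obtain ⟨y', hy'⟩ := h'
    exact ⟨y + y', hy.add hDR hε hy'⟩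
  | neg x _ h =>
    obtain ⟨y, hy⟩ := h
    exact ⟨-y, hy.neg⟩
  | mul x x' _ _ h h' =>
    obtain ⟨y, hy⟩ := h
    obtain ⟨y', hy'⟩ := h'
    exact ⟨y * y', hy.mul hy'⟩

end RetractValue

/-- Let `D` be an integral domain with quotient field `K`, `T` an overring
of `D` (`D ⊆ T ⊆ K`), and `R` a retract `D`-algebra.  We model the situation inside the
quotient field `F` of `R`: `D ≤ R` are subrings of `F`, `K` is the subfield of `F`
generated by `D`, and `T` is a subring with `D ≤ T ⊆ K`.  Then
`RT = Subring.closure (R ∪ T)` is a retract `T`-algebra: there is a ring homomorphism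
`ε' : RT → T` restricting to the identity on `T`. -/
theorem retract_extension_by_overring {F : Type*} [Field F]
    (D R T : Subring F) [IsFractionRing R F] (hDR : D ≤ R) (hDT : D ≤ T)
    (hTK : (T : Set F) ⊆ (Subfield.closure (D : Set F) : Set F))
    (ε : R →+* D) (hε : ∀ d : D, ε (Subring.inclusion hDR d) = d) :
    ∃ ε' : Subring.closure ((R : Set F) ∪ (T : Set F)) →+* T,
      ∀ x : Subring.closure ((R : Set F) ∪ (T : Set F)),
        (x : F) ∈ T → (ε' x : F) = (x : F) := by
  choose f hf using fun x : Subring.closure ((R : Set F) ∪ (T : Set F)) =>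
    RetractValue.exists_of_mem_closure hDR hDT hTK hε x.2
  have hf_eq : ∀ (x : Subring.closure ((R : Set F) ∪ (T : Set F))) (y : T),
      RetractValue ε (x : F) y → f x = y := fun x y h =>
    Subtype.ext ((hf x).unique hDR hε h)
  refine ⟨{ toFun := f
            map_one' := hf_eq 1 1 (by simpa using RetractValue.of_mem (ε := ε) 1)
            map_mul' := fun x y => hf_eq (x * y) (f x * f y) ((hf x).mul (hf y))
            map_zero' := hf_eq 0 0 (by simpa using RetractValue.of_mem (ε := ε) 0)
            map_add' := fun x y => hf_eq (x + y) (f x + f y) ((hf x).add hDR hε (hf y)) }, fun x hx => ?_⟩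
  exact (hf x).unique hDR hε (RetractValue.self_of_mem_closure hDR hε (hTK hx))
end
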